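/- Let A₁, A₂, A₃ be real variables and μ₁, μ₂, μ₃ quaternions. The 3×3 quaternionic Hermitian matrix N = A₁ v₁* v₁ + A₂ v₂* v₂ + A₃ v₃* v₃ with v₁ = (1,0,μ₁), v₂ = (1,1,μ₂), v₃ = (0,1,μ₃) has Moore determinant Nrp(N) = A₁A₂A₃ · (μ₁−μ₂+μ₃)‾(μ₁−μ₂+μ₃). -/

import Mathlib

open MvPolynomial

/-- The standard embedding of the quaternions into `M₂(ℂ)`:
`1 ↦ Id`, `i ↦ diag(i, -i)`, `j ↦ [[0,-1],[1,0]]`, `k ↦ [[0,-i],[-i,0]]`. -/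
noncomputable def quatToM2 (q : Quaternion ℝ) : Matrix (Fin 2) (Fin 2) ℂ :=
  !![(q.re : ℂ) + q.imI * Complex.I, -(q.imJ : ℂ) - q.imK * Complex.I;
     (q.imJ : ℂ) - q.imK * Complex.I, (q.re : ℂ) - q.imI * Complex.I]

/-- The reduced norm of a quaternionic `ι × ι` matrix: the determinant of the associated
complex `2|ι| × 2|ι|` matrix under the standard embedding of the quaternions into `M₂(ℂ)`. -/
noncomputable def Nrd {ι : Type*} [Fintype ι] [DecidableEq ι]
    (M : Matrix ι ι (Quaternion ℝ)) : ℂ :=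
  Matrix.det (Matrix.of fun p q : ι × Fin 2 => quatToM2 (M p.1 q.1) p.2 q.2)

/-- A quaternionic matrix is Hermitian if it equals its conjugate transpose. -/
def QHerm {ι : Type*} (M : Matrix ι ι (Quaternion ℝ)) : Prop :=
  ∀ i j, star (M j i) = M i j

/-- The four real entries of each quaternionic entry of a matrix, as a point at which
multivariable polynomials can be evaluated. -/
def entriesR {ι : Type*} (M : Matrix ι ι (Quaternion ℝ)) : ι × ι × Fin 4 → ℝ :=
  fun x => ![(M x.1 x.2.1).re, (M x.1 x.2.1).imI, (M x.1 x.2.1).imJ, (M x.1 x.2.1).imK] x.2.2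


section Helpers
open Matrix

/-- The complex matrix attached to a quaternionic matrix. -/
noncomputable def toC {ι : Type*} (M : Matrix ι ι (Quaternion ℝ)) :
    Matrix (ι × Fin 2) (ι × Fin 2) ℂ :=
  Matrix.of fun p q : ι × Fin 2 => quatToM2 (M p.1 q.1) p.2 q.2

lemma quatToM2_mul (a b : Quaternion ℝ) : quatToM2 (a * b) = quatToM2 a * quatToM2 b := by
  ext i j
  fin_cases i <;> fin_cases j <;>
    apply Complex.ext <;>
    simp [quatToM2, Matrix.mul_apply, Fin.sum_univ_two] <;> ring

lemma quatToM2_add (a b : Quaternion ℝ) : quatToM2 (a + b) = quatToM2 a + quatToM2 b := by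
  ext i j
  fin_cases i <;> fin_cases j <;>
    apply Complex.ext <;>
    simp [quatToM2] <;> ring

lemma quatToM2_zero : quatToM2 0 = 0 := by
  ext i j
  fin_cases i <;> fin_cases j <;> simp [quatToM2, Quaternion.re_zero, Quaternion.imI_zero,
    Quaternion.imJ_zero, Quaternion.imK_zero]

lemma quatToM2_star (a : Quaternion ℝ) : quatToM2 (star a) = (quatToM2 a)ᴴ := by
  ext i j
  fin_cases i <;> fin_cases j <;> apply Complex.ext <;> simp [quatToM2]

lemma quatToM2_det (a : Quaternion ℝ) : (quatToM2 a).det = ((Quaternion.normSq a : ℝ) : ℂ) := by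
  rw [Matrix.det_fin_two]
  apply Complex.ext <;> simp [quatToM2, Quaternion.normSq_def', ← Complex.ofReal_pow] <;> ring

lemma Nrd_mul (M N : Matrix (Fin 3) (Fin 3) (Quaternion ℝ)) : Nrd (M * N) = Nrd M * Nrd N := by
  unfold Nrd
  rw [← Matrix.det_mul]
  congr 1
  ext p q
  simp [Matrix.mul_apply, Fin.sum_univ_three, quatToM2_add, quatToM2_mul, Fintype.sum_prod_type]

lemma Nrd_conjTranspose (M : Matrix (Fin 3) (Fin 3) (Quaternion ℝ)) :
    Nrd Mᴴ = star (Nrd M) := by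
  unfold Nrd
  rw [← Matrix.det_conjTranspose]
  congr 1
  ext p q
  simp [quatToM2_star]

lemma Nrd_upper (M : Matrix (Fin 3) (Fin 3) (Quaternion ℝ)) (h : ∀ i j, j < i → M i j = 0) :
    Nrd M = ((∏ i, Quaternion.normSq (M i i) : ℝ) : ℂ) := by
  unfold Nrd
  rw [Matrix.BlockTriangular.det_fintype (b := Prod.fst)]
  · push_cast
    refine Finset.prod_congr rfl fun k _ => ?_
    rw [← quatToM2_det]
    let e : Fin 2 ≃ {p : Fin 3 × Fin 2 // p.1 = k} :=
      { toFun := fun i => ⟨(k, i), rfl⟩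
        invFun := fun p => p.1.2
        left_inv := fun i => rfl
        right_inv := by rintro ⟨⟨a, b⟩, rfl⟩; rfl }
    rw [← Matrix.det_submatrix_equiv_self e]
    rfl
  · intro p q hpq
    simp [h _ _ hpq, quatToM2_zero]

/-- Diagonal factor of the path. -/
noncomputable def pD (A : Fin 3 → ℝ) (t : ℝ) : Matrix (Fin 3) (Fin 3) (Quaternion ℝ) :=
  Matrix.diagonal fun e => ((1 + t * (A e - 1) : ℝ) : Quaternion ℝ)

/-- Transpose of the lower triangular factor of the path. -/
noncomputable def pL (t : ℝ) : Matrix (Fin 3) (Fin 3) (Quaternion ℝ) :=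
  !![1, (t : Quaternion ℝ), 0; 0, 1, (t : Quaternion ℝ); 0, 0, 1]

/-- Upper triangular factor of the path. -/
noncomputable def pW (μ : Fin 3 → Quaternion ℝ) (t : ℝ) :
    Matrix (Fin 3) (Fin 3) (Quaternion ℝ) :=
  !![1, 0, (t : Quaternion ℝ) * μ 0; 0, 1, (t : Quaternion ℝ) * (μ 1 - μ 0);
    0, 0, 1 + (t : Quaternion ℝ) * (μ 0 - μ 1 + μ 2 - 1)]

/-- A polynomial path of Hermitian matrices from the identity to `N`. -/
noncomputable def pB (A : Fin 3 → ℝ) (μ : Fin 3 → Quaternion ℝ) (t : ℝ) :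
    Matrix (Fin 3) (Fin 3) (Quaternion ℝ) :=
  ((pL t)ᴴ * pW μ t)ᴴ * pD A t * ((pL t)ᴴ * pW μ t)

/-- The expected value of the Moore determinant along the path. -/
noncomputable def pq (A : Fin 3 → ℝ) (μ : Fin 3 → Quaternion ℝ) (t : ℝ) : ℝ :=
  (∏ e, (1 + t * (A e - 1))) *
    Quaternion.normSq (1 + (t : Quaternion ℝ) * (μ 0 - μ 1 + μ 2 - 1))

lemma pB_herm (A : Fin 3 → ℝ) (μ : Fin 3 → Quaternion ℝ) (t : ℝ) : QHerm (pB A μ t) := by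
  have hD : (pD A t)ᴴ = pD A t := by
    unfold pD
    rw [Matrix.diagonal_conjTranspose]
    congr 1
    funext e
    exact Quaternion.star_coe _
  have : (pB A μ t)ᴴ = pB A μ t := by
    unfold pB
    generalize (pL t)ᴴ * pW μ t = V
    rw [Matrix.conjTranspose_mul, Matrix.conjTranspose_mul, Matrix.conjTranspose_conjTranspose, hD,
      Matrix.mul_assoc]
  intro i j
  exact congrFun (congrFun this i) j

lemma Nrd_pB (A : Fin 3 → ℝ) (μ : Fin 3 → Quaternion ℝ) (t : ℝ) :
    Nrd (pB A μ t) = ((pq A μ t : ℝ) : ℂ) ^ 2 := by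
  have hD : Nrd (pD A t) = ((∏ e, (1 + t * (A e - 1)) ^ 2 : ℝ) : ℂ) := by
    rw [Nrd_upper]
    · simp only [pD, Matrix.diagonal_apply_eq, Quaternion.normSq_coe]
    · intro i j h
      exact Matrix.diagonal_apply_ne _ (ne_of_gt h)
  have hL : Nrd (pL t) = 1 := by
    rw [Nrd_upper]
    · simp [pL, Fin.prod_univ_three]
    · intro i j h
      fin_cases i <;> fin_cases j <;> simp [pL] at h ⊢
  have hW : Nrd (pW μ t) =
      ((Quaternion.normSq (1 + (t : Quaternion ℝ) * (μ 0 - μ 1 + μ 2 - 1)) : ℝ) : ℂ) := by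
    rw [Nrd_upper]
    · simp [pW, Fin.prod_univ_three]
    · intro i j h
      fin_cases i <;> fin_cases j <;> simp [pW] at h ⊢
  simp only [pB, pq, Nrd_mul, Nrd_conjTranspose, hD, hL, hW, Finset.prod_pow]
  simp only [star_mul', star_one, one_mul, star_star, Complex.star_def, Complex.conj_ofReal]
  push_cast
  ring

/-- Componentwise analyticity of a quaternion-valued function. -/
def AQ (f : ℝ → Quaternion ℝ) : Prop :=
  AnalyticOnNhd ℝ (fun t => (f t).re) Set.univ ∧ AnalyticOnNhd ℝ (fun t => (f t).imI) Set.univ ∧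
  AnalyticOnNhd ℝ (fun t => (f t).imJ) Set.univ ∧ AnalyticOnNhd ℝ (fun t => (f t).imK) Set.univ

lemma AQ.add {f g : ℝ → Quaternion ℝ} (hf : AQ f) (hg : AQ g) : AQ (fun t => f t + g t) := by
  obtain ⟨h1, h2, h3, h4⟩ := hf
  obtain ⟨k1, k2, k3, k4⟩ := hg
  exact ⟨h1.add k1, h2.add k2, h3.add k3, h4.add k4⟩

lemma AQ.mul {f g : ℝ → Quaternion ℝ} (hf : AQ f) (hg : AQ g) : AQ (fun t => f t * g t) := by
  obtain ⟨h1, h2, h3, h4⟩ := hf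
  obtain ⟨k1, k2, k3, k4⟩ := hg
  simp only [AQ, Quaternion.re_mul, Quaternion.imI_mul, Quaternion.imJ_mul, Quaternion.imK_mul]
  refine ⟨?_, ?_, ?_, ?_⟩ <;> intro t ht <;>
    replace h1 := h1 t ht <;> replace h2 := h2 t ht <;> replace h3 := h3 t ht <;>
    replace h4 := h4 t ht <;> replace k1 := k1 t ht <;> replace k2 := k2 t ht <;>
    replace k3 := k3 t ht <;> replace k4 := k4 t ht <;> fun_prop

lemma AQ.star {f : ℝ → Quaternion ℝ} (hf : AQ f) : AQ (fun t => star (f t)) := by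
  obtain ⟨h1, h2, h3, h4⟩ := hf
  simp only [AQ, Quaternion.re_star, Quaternion.imI_star, Quaternion.imJ_star, Quaternion.imK_star]
  exact ⟨h1, h2.neg, h3.neg, h4.neg⟩

lemma AQ.const (c : Quaternion ℝ) : AQ (fun _ => c) :=
  ⟨analyticOnNhd_const, analyticOnNhd_const, analyticOnNhd_const, analyticOnNhd_const⟩

lemma AQ.coe {f : ℝ → ℝ} (hf : AnalyticOnNhd ℝ f Set.univ) :
    AQ (fun t => (f t : Quaternion ℝ)) := by
  simp only [AQ, Quaternion.re_coe, Quaternion.imI_coe, Quaternion.imJ_coe, Quaternion.imK_coe]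
  exact ⟨hf, analyticOnNhd_const, analyticOnNhd_const, analyticOnNhd_const⟩

/-- Entrywise analyticity. -/
def AM (F : ℝ → Matrix (Fin 3) (Fin 3) (Quaternion ℝ)) : Prop := ∀ i j, AQ (fun t => F t i j)

lemma AM.mul {F G : ℝ → Matrix (Fin 3) (Fin 3) (Quaternion ℝ)} (hF : AM F) (hG : AM G) :
    AM (fun t => F t * G t) := by
  intro i j
  simp only [Matrix.mul_apply, Fin.sum_univ_three]
  exact (((hF _ _).mul (hG _ _)).add ((hF _ _).mul (hG _ _))).add ((hF _ _).mul (hG _ _))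

lemma AM.ct {F : ℝ → Matrix (Fin 3) (Fin 3) (Quaternion ℝ)} (hF : AM F) :
    AM (fun t => (F t)ᴴ) := fun i j => (hF j i).star

lemma AQ_id : AQ (fun t => (t : Quaternion ℝ)) := AQ.coe analyticOnNhd_id

lemma AM_pB (A : Fin 3 → ℝ) (μ : Fin 3 → Quaternion ℝ) : AM (pB A μ) := by
  have hL : AM pL := by
    intro i j
    fin_cases i <;> fin_cases j <;> first | exact AQ.const _ | exact AQ_id
  have hW : AM (pW μ) := by
    intro i j
    fin_cases i <;> fin_cases j <;> first | exact AQ.const _ | exact AQ_id.mul (AQ.const _) |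
      exact (AQ.const _).add (AQ_id.mul (AQ.const _))
  have hD : AM (pD A) := by
    intro i j
    by_cases h : i = j
    · subst h
      simp only [pD, Matrix.diagonal_apply_eq]
      exact AQ.coe (fun t _ => by fun_prop)
    · simp only [pD, Matrix.diagonal_apply_ne _ h]
      exact AQ.const _
  have hV := hL.ct.mul hW
  exact (hV.ct.mul hD).mul hV

lemma analytic_pq (A : Fin 3 → ℝ) (μ : Fin 3 → Quaternion ℝ) :
    AnalyticOnNhd ℝ (pq A μ) Set.univ := by
  obtain ⟨h1, h2, h3, h4⟩ := (AQ.const 1).add (AQ_id.mul (AQ.const (μ 0 - μ 1 + μ 2 - 1)))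
  have : AnalyticOnNhd ℝ (fun t => pq A μ t) Set.univ := by
    simp only [pq, Quaternion.normSq_def', Fin.prod_univ_three]
    intro t ht
    replace h1 := h1 t ht
    replace h2 := h2 t ht
    replace h3 := h3 t ht
    replace h4 := h4 t ht
    fun_prop
  exact this

lemma analytic_eval (P : MvPolynomial (Fin 3 × Fin 3 × Fin 4) ℝ) (A : Fin 3 → ℝ)
    (μ : Fin 3 → Quaternion ℝ) :
    AnalyticOnNhd ℝ (fun t => eval (entriesR (pB A μ t)) P) Set.univ := by
  have := AnalyticOnNhd.aeval_mvPolynomial (𝕜 := ℝ) (s := Set.univ)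
    (f := fun t => entriesR (pB A μ t)) (fun x => by
      obtain ⟨i, j, k⟩ := x
      obtain ⟨h1, h2, h3, h4⟩ := AM_pB A μ i j
      fin_cases k
      exacts [h1, h2, h3, h4]) P
  simpa [MvPolynomial.aeval_eq_eval] using this

lemma eval_pB (P : MvPolynomial (Fin 3 × Fin 3 × Fin 4) ℝ)
    (hP1 : eval (entriesR (1 : Matrix (Fin 3) (Fin 3) (Quaternion ℝ))) P = 1)
    (hP : ∀ B : Matrix (Fin 3) (Fin 3) (Quaternion ℝ), QHerm B →
      Nrd B = (((eval (entriesR B) P : ℝ) : ℂ)) ^ 2)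
    (A : Fin 3 → ℝ) (μ : Fin 3 → Quaternion ℝ) (t : ℝ) :
    eval (entriesR (pB A μ t)) P = pq A μ t := by
  have hp := analytic_eval P A μ
  have hq := analytic_pq A μ
  have hsq : ∀ s, (eval (entriesR (pB A μ s)) P) ^ 2 = (pq A μ s) ^ 2 := by
    intro s
    have := (hP _ (pB_herm A μ s)).symm.trans (Nrd_pB A μ s)
    exact_mod_cast this
  have hp0 : eval (entriesR (pB A μ 0)) P = 1 := by
    have : pB A μ 0 = 1 := by
      have hL : pL 0 = 1 := by
        ext1 i j
        fin_cases i <;> fin_cases j <;> simp [pL]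
      have hW : pW μ 0 = 1 := by
        ext1 i j
        fin_cases i <;> fin_cases j <;> simp [pW]
      have hD : pD A 0 = 1 := by simp [pD]
      simp [pB, hL, hW, hD]
    rw [this, hP1]
  have hq0 : pq A μ 0 = 1 := by simp [pq]
  have key := AnalyticOnNhd.eq_zero_or_eq_zero_of_mul_eq_zero (hp.sub hq) (hp.add hq)
    (fun s _ => by
      have := hsq s
      simp only [Pi.sub_apply, Pi.add_apply]
      linear_combination this) isPreconnected_univ
  rcases key with h | h
  · exact sub_eq_zero.mp (h t (Set.mem_univ _))
  · have := h 0 (Set.mem_univ _)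
    simp only [Pi.add_apply, hp0, hq0] at this
    norm_num at this

end Helpers

/-- The three-edge banana example: the 3×3 quaternionic Hermitian matrix
`N = A₁ v₁* v₁ + A₂ v₂* v₂ + A₃ v₃* v₃` with `v₁ = (1,0,μ₁)`, `v₂ = (1,1,μ₂)`,
`v₃ = (0,1,μ₃)` has Moore determinant `A₁A₂A₃ · (μ₁−μ₂+μ₃)‾(μ₁−μ₂+μ₃)`.
(The Moore determinant `Nrp` is given by any polynomial `P` with the defining properties
`P(I) = 1` and `P² = Nrd` on Hermitian matrices.) -/
theorem stmt4 (A : Fin 3 → ℝ) (μ : Fin 3 → Quaternion ℝ)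
    (P : MvPolynomial (Fin 3 × Fin 3 × Fin 4) ℝ)
    (hP1 : eval (entriesR (1 : Matrix (Fin 3) (Fin 3) (Quaternion ℝ))) P = 1)
    (hP : ∀ B : Matrix (Fin 3) (Fin 3) (Quaternion ℝ), QHerm B →
      Nrd B = (((eval (entriesR B) P : ℝ) : ℂ)) ^ 2)
    (v : Fin 3 → Fin 3 → Quaternion ℝ)
    (hv0 : v 0 = ![1, 0, μ 0]) (hv1 : v 1 = ![1, 1, μ 1]) (hv2 : v 2 = ![0, 1, μ 2])
    (N : Matrix (Fin 3) (Fin 3) (Quaternion ℝ))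
    (hN : ∀ i j, N i j = ∑ e, A e • (star (v e i) * v e j)) :
    algebraMap ℝ (Quaternion ℝ) (eval (entriesR N) P)
      = (A 0 * A 1 * A 2) • (star (μ 0 - μ 1 + μ 2) * (μ 0 - μ 1 + μ 2)) := by
  have hNB : N = pB A μ 1 := by
    have hLW : (pL 1).conjTranspose * pW μ 1 = Matrix.of v := by
      ext1 i j
      fin_cases i <;> fin_cases j <;>
        simp [pL, pW, Matrix.mul_apply, Fin.sum_univ_three, hv0, hv1, hv2]
      abel
    ext1 i j
    rw [hN, pB, hLW, pD, Matrix.mul_assoc, Matrix.mul_apply]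
    refine Finset.sum_congr rfl fun e _ => ?_
    simp only [Matrix.diagonal_mul, Matrix.conjTranspose_apply, Matrix.of_apply, one_mul,
      add_sub_cancel]
    rw [Quaternion.coe_mul_eq_smul, mul_smul_comm]
  rw [hNB, eval_pB P hP1 hP, pq, Quaternion.star_mul_self, Fin.prod_univ_three]
  simp only [one_mul, add_sub_cancel, Quaternion.coe_one]
  rw [map_mul, Algebra.smul_def]
  rfl
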